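/- arXiv:1007.1491 — 2 statements merged into one kernel-verified Lean document; each statement's English description precedes it below -/
import Mathlib

section
/- Let α ≥ 0 and β > 0 satisfy β − 2α < 2, and let φ₀ be an odd Schwartz function on ℝ (φ₀(−x) = −φ₀(x)). Then for every x ∈ ℝ, ∫_{−∞}^{∞} | |∇|^α φ(x,t) |² dt = (1/(2πβ)) ∫_{−∞}^{∞} (1 − e^{2 i x ξ}) |ξ|^{−(β−1−2α)} |φ̂₀(ξ)|² dξ. -/
open MeasureTheory Real SchwartzMap

noncomputable section

/-- The Fourier transform `φ̂₀(ξ) = ∫ e^{-i x ξ} φ₀(x) dx` on `ℝ`. -/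
def fourierInt1 (f : ℝ → ℂ) (ξ : ℝ) : ℂ :=
  ∫ x : ℝ, Complex.exp (-(Complex.I * ((x * ξ : ℝ) : ℂ))) * f x

/-- `|∇|^α φ(x,t) = (2π)^{-1} ∫ |ξ|^α e^{i x ξ} e^{-i t |ξ|^β} φ̂₀(ξ) dξ`, where `φ` is the
solution of `i φ_t = (-Δ)^{β/2} φ` on `ℝ^{1+1}` with initial data `φ₀`. -/
def gradProp1 (α β : ℝ) (φ₀ : 𝓢(ℝ, ℂ)) (x t : ℝ) : ℂ :=
  ((2 * π : ℝ))⁻¹ *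
    ∫ ξ : ℝ,
      ((|ξ| ^ α : ℝ) : ℂ) * Complex.exp (Complex.I * ((x * ξ : ℝ) : ℂ)) *
        Complex.exp (-(Complex.I * (t : ℂ) * ((|ξ| ^ β : ℝ) : ℂ))) *
          fourierInt1 (fun y => φ₀ y) ξ

end

open scoped FourierTransform ContDiff

theorem aux_fourier_ae (f : ℝ → ℂ) (h1 : Integrable f) (h2 : MemLp f 2) :
    ((𝓕 (h2.toLp f) : Lp ℂ 2 (volume : Measure ℝ)) : ℝ → ℂ) =ᵐ[volume] 𝓕 f := by
  have hc : Continuous (𝓕 f) :=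
    VectorFourier.fourierIntegral_continuous Real.continuous_fourierChar
      (by exact continuous_inner) h1
  apply ae_eq_of_integral_contDiff_smul_eq
  · exact (Lp.memLp _).locallyIntegrable (by norm_num)
  · exact hc.locallyIntegrable
  · intro g g_smooth g_cpt
    have hg₁ : HasCompactSupport (Complex.ofRealCLM ∘ g) := g_cpt.comp_left rfl
    have hg₂ : ContDiff ℝ ∞ (Complex.ofRealCLM ∘ g) := by fun_prop
    set G : 𝓢(ℝ, ℂ) := hg₁.toSchwartzMap hg₂ with hG
    have hGa : ∀ t, G t = (g t : ℂ) := fun t => rfl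
    have e1 := congrArg (fun T : TemperedDistribution ℝ ℂ => T G)
      (Lp.fourier_toTemperedDistribution_eq (h2.toLp f))
    simp only [TemperedDistribution.fourier_apply, Lp.toTemperedDistribution_apply] at e1
    have e2 : ∫ ξ, 𝓕 (G : ℝ → ℂ) ξ • f ξ = ∫ t, G t • 𝓕 f t := by
      simpa using! VectorFourier.integral_fourierIntegral_smul_eq_flip (L := innerₗ ℝ)
        continuous_fourierChar continuous_inner G.integrable h1
    have e3 : ∫ ξ, (𝓕 G) ξ • (h2.toLp f) ξ = ∫ ξ, 𝓕 (G : ℝ → ℂ) ξ • f ξ := by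
      apply integral_congr_ae
      filter_upwards [h2.coeFn_toLp] with ξ h
      rw [h, SchwartzMap.fourier_coe]
    calc _ = ∫ t, G t • (𝓕 (h2.toLp f) : Lp ℂ 2 (volume : Measure ℝ)) t := by
            simp [hGa]
      _ = ∫ t, G t • 𝓕 f t := by rw [← e1, e3, e2]
      _ = _ := by simp [hGa]

theorem aux_int_sq (f : Lp ℂ 2 (volume : Measure ℝ)) :
    inner ℂ f f = ((∫ t, ‖f t‖ ^ 2 : ℝ) : ℂ) := by
  rw [L2.inner_def, ← integral_complex_ofReal]
  congr with t
  rw [inner_self_eq_norm_sq_to_K]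
  simp

theorem aux_plancherel (f : ℝ → ℂ) (h1 : Integrable f) (h2 : MemLp f 2) :
    ∫ t, ‖𝓕 f t‖ ^ 2 = ∫ t, ‖f t‖ ^ 2 := by
  have h := Lp.inner_fourier_eq (h2.toLp f) (h2.toLp f)
  rw [aux_int_sq, aux_int_sq] at h
  have h := Complex.ofReal_injective h
  calc _ = ∫ t, ‖(𝓕 (h2.toLp f) : Lp ℂ 2 (volume : Measure ℝ)) t‖ ^ 2 := by
        apply integral_congr_ae
        filter_upwards [aux_fourier_ae f h1 h2] with t ht
        rw [ht]
    _ = _ := h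
    _ = _ := by
        apply integral_congr_ae
        filter_upwards [h2.coeFn_toLp] with t ht
        rw [ht]

theorem aux_fold {f : ℝ → ℂ} (hf : Integrable f) :
    ∫ t, f t = ∫ t in Set.Ioi (0:ℝ), (f t + f (-t)) := by
  rw [integral_add hf.integrableOn hf.comp_neg.integrableOn, integral_comp_neg_Ioi, neg_zero,
    add_comm, intervalIntegral.integral_Iic_add_Ioi hf.integrableOn hf.integrableOn]

/-- integrability -/
theorem aux_integrable (ψ : 𝓢(ℝ, ℂ)) (a : ℝ) (ha : -1 < a) :
    IntegrableOn (fun ξ : ℝ => |ξ| ^ a * ‖ψ ξ‖) (Set.Ioi 0) := by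
  have hm : Measurable (fun ξ : ℝ => |ξ| ^ a * ‖ψ ξ‖) := by
    have := ψ.continuous.measurable
    fun_prop
  obtain ⟨C, hC0, hC⟩ := ψ.decay 0 0
  obtain ⟨n, hn⟩ := exists_nat_gt (a + 1)
  obtain ⟨D, hD0, hD⟩ := ψ.decay n 0
  simp only [pow_zero, one_mul, norm_iteratedFDeriv_zero] at hC hD
  rw [← Set.Ioc_union_Ioi_eq_Ioi (zero_le_one' ℝ)]
  apply IntegrableOn.union
  · have : IntegrableOn (fun ξ : ℝ => ξ ^ a * C) (Set.Ioc 0 1) :=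
      ((intervalIntegrable_iff_integrableOn_Ioc_of_le zero_le_one).1
        (intervalIntegral.intervalIntegrable_rpow' ha)).mul_const C
    refine Integrable.mono' this hm.aestronglyMeasurable ?_
    filter_upwards [ae_restrict_mem measurableSet_Ioc] with ξ hξ
    rw [norm_of_nonneg (by positivity), abs_of_pos hξ.1]
    have := hξ.1
    gcongr
    exact hC ξ
  · have : IntegrableOn (fun ξ : ℝ => ξ ^ (a - n) * D) (Set.Ioi 1) :=
      (integrableOn_Ioi_rpow_of_lt (by linarith) one_pos).mul_const D
    refine Integrable.mono' this hm.aestronglyMeasurable ?_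
    filter_upwards [ae_restrict_mem measurableSet_Ioi] with ξ hξ
    have h0 : 0 < ξ := one_pos.trans hξ
    rw [norm_of_nonneg (by positivity), abs_of_pos h0]
    have := hD ξ
    rw [norm_of_nonneg h0.le] at this
    rw [rpow_sub h0, rpow_natCast]
    rw [div_mul_eq_mul_div, mul_div_assoc]
    gcongr
    rw [le_div_iff₀ (by positivity)]
    linarith

theorem aux_F (φ₀ : 𝓢(ℝ, ℂ)) : ∃ ψ : 𝓢(ℝ, ℂ), ∀ ξ, fourierInt1 (fun y => φ₀ y) ξ = ψ ξ := by
  have hne : (2 * π)⁻¹ ≠ 0 := by positivity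
  refine ⟨SchwartzMap.compCLMOfContinuousLinearEquiv ℂ
    (ContinuousLinearEquiv.unitsEquivAut ℝ (Units.mk0 _ hne)) (𝓕 φ₀), fun ξ => ?_⟩
  rw [SchwartzMap.compCLMOfContinuousLinearEquiv_apply, Function.comp_apply,
    SchwartzMap.fourier_coe, Real.fourier_real_eq_integral_exp_smul]
  unfold fourierInt1
  congr with y
  rw [smul_eq_mul]
  congr 2
  simp
  field_simp

theorem aux_odd (φ₀ : 𝓢(ℝ, ℂ)) (hodd : ∀ y : ℝ, φ₀ (-y) = -φ₀ y) (ξ : ℝ) :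
    fourierInt1 (fun y => φ₀ y) (-ξ) = - fourierInt1 (fun y => φ₀ y) ξ := by
  unfold fourierInt1
  rw [← integral_neg_eq_self, ← integral_neg]
  congr with y
  simp [hodd]

theorem aux_integrable' (ψ : 𝓢(ℝ, ℂ)) (hψ : ∀ ξ, ψ (-ξ) = - ψ ξ) (a : ℝ) (ha : -1 < a) :
    Integrable (fun ξ : ℝ => |ξ| ^ a * ‖ψ ξ‖) := by
  have h := aux_integrable ψ a ha
  rw [← integrableOn_univ, ← Set.Iic_union_Ioi (a := (0:ℝ))]
  refine IntegrableOn.union ?_ h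
  rw [integrableOn_Iic_iff_integrableOn_Iio]
  have h' : IntegrableOn (fun ξ : ℝ => |ξ| ^ a * ‖ψ ξ‖) (Set.Ioi (-0)) := by simpa using h
  have := h'.comp_neg_Iio
  simpa [hψ] using this

/-- half-line profile -/
noncomputable def auxH (α x : ℝ) (ψ : ℝ → ℂ) (ξ : ℝ) : ℂ :=
  ((ξ ^ α : ℝ) : ℂ) * (2 * Complex.I * ((Real.sin (x * ξ) : ℝ) : ℂ)) * ψ ξ

/-- profile in the variable `s = ξ ^ β` -/
noncomputable def auxW (α β x : ℝ) (ψ : ℝ → ℂ) : ℝ → ℂ :=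
  (Set.Ioi (0:ℝ)).indicator fun s =>
    ((β⁻¹ * s ^ (β⁻¹ - 1) : ℝ) : ℂ) * auxH α x ψ (s ^ β⁻¹)

theorem auxW_apply (α β x : ℝ) (hβ : 0 < β) (ψ : ℝ → ℂ) {ξ : ℝ} (hξ : 0 < ξ) :
    auxW α β x ψ (ξ ^ β) = ((β⁻¹ * ξ ^ (1 - β) : ℝ) : ℂ) * auxH α x ψ ξ := by
  have hp : ξ ^ β ∈ Set.Ioi (0:ℝ) := rpow_pos_of_pos hξ β
  rw [auxW, Set.indicator_of_mem hp, ← rpow_mul hξ.le, ← rpow_mul hξ.le,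
    mul_inv_cancel₀ hβ.ne', rpow_one]
  congr 5
  field_simp

theorem auxW_smul (α β x : ℝ) (hβ : 0 < β) (ψ : ℝ → ℂ) {ξ : ℝ} (hξ : 0 < ξ) :
    ((β * ξ ^ (β - 1) : ℝ) : ℂ) * auxW α β x ψ (ξ ^ β) = auxH α x ψ ξ := by
  rw [auxW_apply α β x hβ ψ hξ, ← mul_assoc, ← Complex.ofReal_mul]
  have : β * ξ ^ (β - 1) * (β⁻¹ * ξ ^ (1 - β)) = 1 := by
    rw [show β * ξ ^ (β - 1) * (β⁻¹ * ξ ^ (1 - β)) = (β * β⁻¹) * (ξ ^ (β - 1) * ξ ^ (1 - β)) by ring,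
      ← rpow_add hξ, mul_inv_cancel₀ hβ.ne']
    simp
  rw [this]; simp

theorem auxH_norm (α x : ℝ) (ψ : ℝ → ℂ) {ξ : ℝ} (hξ : 0 < ξ) :
    ‖auxH α x ψ ξ‖ = ξ ^ α * (2 * |Real.sin (x * ξ)|) * ‖ψ ξ‖ := by
  have : 0 ≤ ξ ^ α := by positivity
  simp only [auxH, norm_mul, Complex.norm_real, Complex.norm_I, Real.norm_eq_abs, abs_of_nonneg this]
  simp

theorem auxW_sq (α β x : ℝ) (hβ : 0 < β) (ψ : ℝ → ℂ) {ξ : ℝ} (hξ : 0 < ξ) :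
    (β * ξ ^ (β - 1)) * ‖auxW α β x ψ (ξ ^ β)‖ ^ 2 =
      β⁻¹ * (ξ ^ (-(β - 1 - 2 * α)) * (4 * Real.sin (x * ξ) ^ 2) * ‖ψ ξ‖ ^ 2) := by
  have hW := congrArg norm (auxW_smul α β x hβ ψ hξ)
  have hA := congrArg norm (auxW_apply α β x hβ ψ hξ)
  have p1 : 0 ≤ β * ξ ^ (β - 1) := by positivity
  have p2 : 0 ≤ β⁻¹ * ξ ^ (1 - β) := by positivity
  rw [norm_mul, Complex.norm_real, norm_of_nonneg p1] at hW
  rw [norm_mul, Complex.norm_real, norm_of_nonneg p2] at hA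
  rw [sq ‖auxW α β x ψ (ξ ^ β)‖, ← mul_assoc, hW, hA, auxH_norm α x ψ hξ]
  have e : ξ ^ (-(β - 1 - 2 * α)) = ξ ^ (1 - β) * ξ ^ α * ξ ^ α := by
    rw [← rpow_add hξ, ← rpow_add hξ]; congr 1; ring
  rw [e, ← sq_abs (Real.sin (x * ξ))]
  ring

theorem auxW_integrable (α β x : ℝ) (hα : 0 ≤ α) (hβ : 0 < β) (ψ : 𝓢(ℝ, ℂ)) :
    Integrable (auxW α β x ψ) := by
  have hH : IntegrableOn (auxH α x ψ) (Set.Ioi 0) := by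
    have hm : Measurable (auxH α x ψ) := by
      have := ψ.continuous.measurable
      unfold auxH
      fun_prop
    refine Integrable.mono' ((aux_integrable ψ α (by linarith)).const_mul 2)
      hm.aestronglyMeasurable ?_
    filter_upwards [ae_restrict_mem measurableSet_Ioi] with ξ hξ
    have hξ : 0 < ξ := hξ
    rw [auxH_norm α x ψ hξ, abs_of_pos hξ]
    have := Real.abs_sin_le_one (x * ξ)
    have q : 0 ≤ ξ ^ α * ‖ψ ξ‖ := by positivity
    nlinarith
  have h2 : IntegrableOn (auxW α β x ψ) (Set.Ioi 0) := by
    rw [← integrableOn_Ioi_comp_rpow_iff _ hβ.ne']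
    refine hH.congr_fun (fun ξ hξ => ?_) measurableSet_Ioi
    rw [abs_of_pos hβ, Complex.real_smul]
    exact (auxW_smul α β x hβ ψ hξ).symm
  rw [auxW, integrableOn_indicator_iff measurableSet_Ioi, Set.inter_self] at h2
  rw [auxW]
  exact (integrable_indicator_iff measurableSet_Ioi).2 h2

theorem aux_int_sq_full (γ : ℝ) (hγ : -1 < γ) (ψ : 𝓢(ℝ, ℂ)) (hψ : ∀ ξ, ψ (-ξ) = - ψ ξ) :
    Integrable (fun ξ : ℝ => |ξ| ^ γ * ‖ψ ξ‖ ^ 2) := by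
  obtain ⟨C, hC0, hC⟩ := ψ.decay 0 0
  simp only [pow_zero, one_mul, norm_iteratedFDeriv_zero] at hC
  have hm : Measurable (fun ξ : ℝ => |ξ| ^ γ * ‖ψ ξ‖ ^ 2) := by
    have := ψ.continuous.measurable
    fun_prop
  refine Integrable.mono' ((aux_integrable' ψ hψ γ hγ).const_mul C) hm.aestronglyMeasurable ?_
  filter_upwards with ξ
  rw [norm_of_nonneg (by positivity)]
  have := hC ξ
  have q : 0 ≤ |ξ| ^ γ * ‖ψ ξ‖ := by positivity
  nlinarith

theorem auxW_memLp (α β x : ℝ) (hα : 0 ≤ α) (hβ : 0 < β) (h2 : β - 2 * α < 2)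
    (ψ : 𝓢(ℝ, ℂ)) (hψ : ∀ ξ, ψ (-ξ) = - ψ ξ) :
    MemLp (auxW α β x ψ) 2 := by
  rw [memLp_two_iff_integrable_sq_norm (auxW_integrable α β x hα hβ ψ).1]
  have hs : (fun s => ‖auxW α β x ψ s‖ ^ 2) =
      (Set.Ioi (0:ℝ)).indicator (fun s => ‖auxW α β x ψ s‖ ^ 2) := by
    ext s
    by_cases h : s ∈ Set.Ioi (0:ℝ)
    · rw [Set.indicator_of_mem h]
    · rw [Set.indicator_of_notMem h, auxW, Set.indicator_of_notMem h]; simp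
  rw [hs, integrable_indicator_iff measurableSet_Ioi, ← integrableOn_Ioi_comp_rpow_iff _ hβ.ne']
  have hm : Measurable (fun ξ : ℝ => 
      β⁻¹ * (ξ ^ (-(β - 1 - 2 * α)) * (4 * Real.sin (x * ξ) ^ 2) * ‖ψ ξ‖ ^ 2)) := by
    have := ψ.continuous.measurable
    fun_prop
  have : IntegrableOn (fun ξ : ℝ => 
      β⁻¹ * (ξ ^ (-(β - 1 - 2 * α)) * (4 * Real.sin (x * ξ) ^ 2) * ‖ψ ξ‖ ^ 2)) (Set.Ioi 0) := by
    refine Integrable.mono' 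
      (((aux_int_sq_full (-(β - 1 - 2 * α)) (by linarith) ψ hψ).const_mul (4 * β⁻¹)).integrableOn)
      hm.aestronglyMeasurable ?_
    filter_upwards [ae_restrict_mem measurableSet_Ioi] with ξ hξ
    have hξ : 0 < ξ := hξ
    rw [norm_of_nonneg (by positivity), abs_of_pos hξ]
    have := Real.sin_sq_le_one (x * ξ)
    have q : 0 ≤ β⁻¹ * (ξ ^ (-(β - 1 - 2 * α)) * ‖ψ ξ‖ ^ 2) := by positivity
    nlinarith
  refine this.congr_fun (fun ξ hξ => ?_) measurableSet_Ioi
  rw [abs_of_pos hβ, smul_eq_mul]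
  exact (auxW_sq α β x hβ ψ hξ).symm

theorem auxW_int_sq (α β x : ℝ) (hβ : 0 < β) (ψ : ℝ → ℂ) :
    ∫ s, ‖auxW α β x ψ s‖ ^ 2 = β⁻¹ * ∫ ξ in Set.Ioi (0:ℝ),
      ξ ^ (-(β - 1 - 2 * α)) * (4 * Real.sin (x * ξ) ^ 2) * ‖ψ ξ‖ ^ 2 := by
  rw [← setIntegral_eq_integral_of_forall_compl_eq_zero (s := Set.Ioi (0:ℝ)),
    ← integral_comp_rpow_Ioi_of_pos hβ, ← integral_const_mul]
  · refine setIntegral_congr_fun measurableSet_Ioi fun ξ hξ => ?_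
    exact auxW_sq α β x hβ ψ hξ
  · intro s hs
    rw [auxW, Set.indicator_of_notMem hs]; simp

theorem aux_grad (α β : ℝ) (hα : 0 ≤ α) (hβ : 0 < β) (φ₀ ψ : 𝓢(ℝ, ℂ))
    (hF : ∀ ξ, fourierInt1 (fun y => φ₀ y) ξ = ψ ξ) (hψ : ∀ ξ, ψ (-ξ) = - ψ ξ) (x t : ℝ) :
    gradProp1 α β φ₀ x t = (((2 * π)⁻¹ : ℝ) : ℂ) * 𝓕 (auxW α β x ψ) ((2 * π)⁻¹ * t) := by
  rw [gradProp1, Real.fourier_real_eq_integral_exp_smul, aux_fold]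
  · simp only [Complex.ofReal_inv]
    congr 1
    conv_rhs => rw [← setIntegral_eq_integral_of_forall_compl_eq_zero (s := Set.Ioi (0:ℝ))
      (by intro s hs; rw [auxW, Set.indicator_of_notMem hs]; simp),
      ← integral_comp_rpow_Ioi_of_pos hβ]
    · refine setIntegral_congr_fun measurableSet_Ioi fun ξ hξ => ?_
      have hξ : 0 < ξ := hξ
      simp only [hF, hψ, abs_neg, abs_of_pos hξ]
      rw [Complex.real_smul, smul_eq_mul, mul_left_comm, auxW_smul α β x hβ ψ hξ, auxH]
      have e1 : ((-2 * π * ξ ^ β * ((2 * π)⁻¹ * t) : ℝ) : ℂ) * Complex.I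
          = -(Complex.I * (t : ℂ) * ((ξ ^ β : ℝ) : ℂ)) := by
        have : -2 * π * ξ ^ β * ((2 * π)⁻¹ * t) = -(t * ξ ^ β) := by
          field_simp
        rw [this]; push_cast; ring
      rw [e1]
      have e2 : 2 * Complex.I * ((Real.sin (x * ξ) : ℝ) : ℂ) =
          Complex.exp (Complex.I * ((x * ξ : ℝ) : ℂ)) -
            Complex.exp (Complex.I * ((x * -ξ : ℝ) : ℂ)) := by
        rw [Complex.ofReal_sin, Complex.sin]
        rw [show Complex.I * ((x * -ξ : ℝ) : ℂ) = -((x * ξ : ℝ) : ℂ) * Complex.I by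
          push_cast; ring, mul_comm Complex.I ((x * ξ : ℝ) : ℂ)]
        linear_combination (Complex.exp (-((x * ξ : ℝ) : ℂ) * Complex.I) -
          Complex.exp (((x * ξ : ℝ) : ℂ) * Complex.I)) * Complex.I_sq
      rw [e2]
      ring
  · have hm : Measurable (fun ξ : ℝ => ((|ξ| ^ α : ℝ) : ℂ) *
        Complex.exp (Complex.I * ((x * ξ : ℝ) : ℂ)) *
        Complex.exp (-(Complex.I * (t : ℂ) * ((|ξ| ^ β : ℝ) : ℂ))) *
          fourierInt1 (fun y => φ₀ y) ξ) := by
      have := ψ.continuous.measurable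
      simp only [hF]
      fun_prop
    refine Integrable.mono' (aux_integrable' ψ hψ α (by linarith)) hm.aestronglyMeasurable ?_
    filter_upwards with ξ
    rw [hF, norm_mul, norm_mul, norm_mul, Complex.norm_real, norm_of_nonneg (by positivity),
      mul_comm Complex.I, Complex.norm_exp_ofReal_mul_I,
      show -(Complex.I * (t : ℂ) * ((|ξ| ^ β : ℝ) : ℂ)) = ((-(t * |ξ| ^ β) : ℝ) : ℂ) * Complex.I by
        push_cast; ring, Complex.norm_exp_ofReal_mul_I]
    simp

theorem aux_rhs (γ x : ℝ) (hγ : -1 < γ) (ψ : 𝓢(ℝ, ℂ)) (hψ : ∀ ξ, ψ (-ξ) = - ψ ξ) :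
    ∫ ξ : ℝ, (1 - Complex.exp (2 * Complex.I * ((x * ξ : ℝ) : ℂ))) *
            ((|ξ| ^ γ : ℝ) : ℂ) * ((‖ψ ξ‖ ^ 2 : ℝ) : ℂ) =
    ((∫ ξ in Set.Ioi (0:ℝ), ξ ^ γ * (4 * Real.sin (x * ξ) ^ 2) * ‖ψ ξ‖ ^ 2 : ℝ) : ℂ) := by
  rw [aux_fold, ← integral_complex_ofReal]
  · refine setIntegral_congr_fun measurableSet_Ioi fun ξ hξ => ?_
    have hξ : 0 < ξ := hξ
    simp only [hψ, abs_neg, norm_neg, abs_of_pos hξ]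
    have e : 4 * Complex.sin ((x * ξ : ℝ) : ℂ) ^ 2 =
        (1 - Complex.exp (2 * Complex.I * ((x * ξ : ℝ) : ℂ))) +
        (1 - Complex.exp (2 * Complex.I * ((x * -ξ : ℝ) : ℂ))) := by
      have c := Complex.cos_two_mul ((x * ξ : ℝ) : ℂ)
      have s := Complex.sin_sq_add_cos_sq ((x * ξ : ℝ) : ℂ)
      rw [Complex.cos] at c
      rw [show 2 * Complex.I * ((x * -ξ : ℝ) : ℂ) = -(2 * ((x * ξ : ℝ) : ℂ)) * Complex.I by
        push_cast; ring, show 2 * Complex.I * ((x * ξ : ℝ) : ℂ) =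
        (2 * ((x * ξ : ℝ) : ℂ)) * Complex.I by ring]
      linear_combination 4 * s + 2 * c
    have e' : ((ξ ^ γ * (4 * Real.sin (x * ξ) ^ 2) * ‖ψ ξ‖ ^ 2 : ℝ) : ℂ) =
        ((ξ ^ γ : ℝ) : ℂ) * (4 * Complex.sin ((x * ξ : ℝ) : ℂ) ^ 2) * ((‖ψ ξ‖ ^ 2 : ℝ) : ℂ) := by
      push_cast; ring
    rw [e', e]
    ring
  · have hm : Measurable (fun ξ : ℝ => (1 - Complex.exp (2 * Complex.I * ((x * ξ : ℝ) : ℂ))) *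
            ((|ξ| ^ γ : ℝ) : ℂ) * ((‖ψ ξ‖ ^ 2 : ℝ) : ℂ)) := by
      have := ψ.continuous.measurable
      fun_prop
    refine Integrable.mono' ((aux_int_sq_full γ hγ ψ hψ).const_mul 2) hm.aestronglyMeasurable ?_
    filter_upwards with ξ
    have hb : ‖1 - Complex.exp (2 * Complex.I * ((x * ξ : ℝ) : ℂ))‖ ≤ 2 := by
      refine (norm_sub_le _ _).trans ?_
      rw [show 2 * Complex.I * ((x * ξ : ℝ) : ℂ) = ((2 * (x * ξ) : ℝ) : ℂ) * Complex.I by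
        push_cast; ring, Complex.norm_exp_ofReal_mul_I]
      norm_num
    rw [norm_mul, norm_mul, Complex.norm_real, Complex.norm_real, norm_of_nonneg (by positivity),
      norm_of_nonneg (by positivity), mul_assoc]
    gcongr

/-- For odd data on `ℝ` and `β - 2α < 2`, `β > 0`, the time integral of
`| |∇|^α φ(x,t) |²` equals
`(2πβ)⁻¹ ∫ (1 - e^{2 i x ξ}) |ξ|^{-(β-1-2α)} |φ̂₀(ξ)|² dξ`. -/
theorem time_integral_odd_data_1d (α β : ℝ) (hα : 0 ≤ α) (hβ : 0 < β)
    (h2 : β - 2 * α < 2) (φ₀ : SchwartzMap ℝ ℂ) (hodd : ∀ y : ℝ, φ₀ (-y) = -φ₀ y)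
    (x : ℝ) :
    ((∫ t : ℝ, ‖gradProp1 α β φ₀ x t‖ ^ 2 : ℝ) : ℂ) =
      ((2 * π * β : ℝ) : ℂ)⁻¹ *
        ∫ ξ : ℝ,
          (1 - Complex.exp (2 * Complex.I * ((x * ξ : ℝ) : ℂ))) *
            ((|ξ| ^ (-(β - 1 - 2 * α)) : ℝ) : ℂ) *
              ((‖fourierInt1 (fun y => φ₀ y) ξ‖ ^ 2 : ℝ) : ℂ) := by
  obtain ⟨ψ, hF⟩ := aux_F φ₀
  have hψ : ∀ ξ, ψ (-ξ) = - ψ ξ := fun ξ => by rw [← hF, ← hF, aux_odd φ₀ hodd]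
  simp only [hF]
  rw [aux_rhs _ x (by linarith) ψ hψ]
  simp only [aux_grad α β hα hβ φ₀ ψ hF hψ, norm_mul, mul_pow, Complex.norm_real]
  rw [integral_const_mul,
    Measure.integral_comp_mul_left (fun s => ‖𝓕 (auxW α β x ψ) s‖ ^ 2) ((2 * π)⁻¹),
    aux_plancherel _ (auxW_integrable α β x hα hβ ψ) (auxW_memLp α β x hα hβ h2 ψ hψ),
    auxW_int_sq α β x hβ ψ, ← Complex.ofReal_inv, ← Complex.ofReal_mul]
  congr 1
  have hp := Real.pi_pos
  rw [norm_of_nonneg (by positivity), inv_inv, abs_of_pos (by positivity), smul_eq_mul]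
  generalize (∫ ξ in Set.Ioi (0:ℝ), _ : ℝ) = J
  field_simp
end

section
/- Let α ≥ 0 and β > 0 satisfy β − 2α < 2, and let φ₀ be an even Schwartz function on ℝ (φ₀(−x) = φ₀(x)). Then for every x ∈ ℝ, ∫_{−∞}^{∞} | |∇|^α φ(x,t) |² dt = (1/(2πβ)) ∫_{−∞}^{∞} (1 + e^{2 i x ξ}) |ξ|^{−(β−1−2α)} |φ̂₀(ξ)|² dξ. -/
open MeasureTheory Real SchwartzMap

open MeasureTheory Real SchwartzMap FourierTransform
open scoped ContDiff

lemma planch (f : ℝ → ℂ) (h1 : Integrable f) (h2 : MemLp f 2) :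
    ∫ w, ‖𝓕 f w‖ ^ 2 = ∫ s, ‖f s‖ ^ 2 := by
  set u := h2.toLp f with hu
  have hcont : Continuous (𝓕 f) :=
    VectorFourier.fourierIntegral_continuous Real.continuous_fourierChar (by exact continuous_inner) h1
  have hae : ∀ᵐ w, 𝓕 f w = (𝓕 u : Lp ℂ 2 (volume : Measure ℝ)) w := by
    apply ae_eq_of_integral_contDiff_smul_eq
    · exact hcont.locallyIntegrable
    · exact (Lp.memLp _).locallyIntegrable (by norm_num)
    · intro g g_smooth g_cpt
      have hg₁ : HasCompactSupport (Complex.ofRealCLM ∘ g) := g_cpt.comp_left rfl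
      have hg₂ : ContDiff ℝ ∞ (Complex.ofRealCLM ∘ g) := by fun_prop
      have key := DFunLike.congr_fun (Lp.fourier_toTemperedDistribution_eq u) (hg₁.toSchwartzMap hg₂)
      rw [TemperedDistribution.fourier_apply] at key
      simp only [Lp.toTemperedDistribution_apply] at key
      calc ∫ x, g x • 𝓕 f x = ∫ x, (hg₁.toSchwartzMap hg₂) x • 𝓕 f x := by simp
        _ = ∫ x, 𝓕 (hg₁.toSchwartzMap hg₂) x • f x := by
          have := VectorFourier.integral_fourierIntegral_smul_eq_flip (L := innerₗ ℝ) (μ := volume) (ν := volume)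
            Real.continuous_fourierChar continuous_inner (hg₁.toSchwartzMap hg₂).integrable h1
          simpa using! this.symm
        _ = ∫ x, 𝓕 (hg₁.toSchwartzMap hg₂) x • u x := by
          apply integral_congr_ae
          filter_upwards [h2.coeFn_toLp] with x hx
          rw [hx]
        _ = _ := by rw [key]; simp
  have e1 : ∫ w, ‖𝓕 f w‖ ^ 2 = ∫ w, ‖(𝓕 u : Lp ℂ 2 (volume : Measure ℝ)) w‖ ^ 2 := by
    apply integral_congr_ae
    filter_upwards [hae] with x hx
    rw [hx]
  have e2 : ∫ w, ‖f w‖ ^ 2 = ∫ w, ‖u w‖ ^ 2 := by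
    apply integral_congr_ae
    filter_upwards [h2.coeFn_toLp] with x hx
    rw [hx]
  have L (v : Lp ℂ 2 (volume : Measure ℝ)) : ∫ w, ‖v w‖ ^ 2 = ‖v‖^2 := by
    have := L2.inner_def (𝕜 := ℂ) v v
    rw [inner_self_eq_norm_sq_to_K] at this
    simp only [inner_self_eq_norm_sq_to_K] at this
    apply Complex.ofRealLI.injective
    rw [← LinearIsometry.integral_comp_comm]
    simpa using this.symm
  rw [e1, e2, L, L, Lp.norm_fourier_eq]

lemma fold (f : ℝ → ℂ) (h1 : IntegrableOn f (Set.Ioi 0)) (h2 : IntegrableOn (fun x => f (-x)) (Set.Ioi 0)) :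
    ∫ x, f x = ∫ x in Set.Ioi 0, (f x + f (-x)) := by
  have h3 : IntegrableOn f (Set.Iic 0) := by
    rw [integrableOn_Iic_iff_integrableOn_Iio]
    have h2' : IntegrableOn (fun x => f (-x)) (Set.Ioi (-0)) := by simpa using h2
    simpa using h2'.comp_neg_Iio
  rw [integral_add h1 h2, integral_comp_neg_Ioi, ← intervalIntegral.integral_Iic_add_Ioi h3 h1, neg_zero, add_comm]

lemma intpow (G : ℝ → ℂ) (hc : Continuous G) (hd : ∀ k : ℕ, ∃ C, ∀ ξ, |ξ| ^ k * ‖G ξ‖ ≤ C) (s : ℝ) (hs : -1 < s) :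
    IntegrableOn (fun ξ => ((ξ ^ s : ℝ) : ℂ) * G ξ) (Set.Ioi 0) := by
  obtain ⟨k, hk⟩ := exists_nat_gt (s + 1)
  have h := mellin_convergent_of_isBigO_scalar (f := fun t => ‖G t‖) (s := s + 1) (a := k) (b := 0)
    (hc.norm.locallyIntegrable.locallyIntegrableOn _) ?_ hk ?_ (by linarith)
  · rw [IntegrableOn, ← integrable_norm_iff]
    · refine h.congr_fun ?_ measurableSet_Ioi
      intro t ht
      have : 0 ≤ t ^ s := rpow_nonneg (le_of_lt ht) _
      simp [abs_of_nonneg this]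
    · apply AEStronglyMeasurable.mul _ hc.aestronglyMeasurable
      exact (by fun_prop : Measurable fun ξ : ℝ => ((ξ ^ s : ℝ) : ℂ)).aestronglyMeasurable
  · obtain ⟨C, hC⟩ := hd k
    apply Asymptotics.IsBigO.of_bound C
    filter_upwards [Filter.eventually_gt_atTop 0] with t ht
    have := hC t
    rw [abs_of_pos ht] at this
    have h3 : 0 < t ^ k := by positivity
    rw [rpow_neg ht.le, rpow_natCast, norm_norm, norm_of_nonneg (by positivity), ← div_eq_mul_inv, le_div_iff₀ h3]
    linarith
  · obtain ⟨C, hC⟩ := hd 0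
    apply Asymptotics.IsBigO.of_bound C
    filter_upwards with t
    simpa using hC t

lemma fourierInt1_eq (φ₀ : SchwartzMap ℝ ℂ) (ξ : ℝ) :
    fourierInt1 (fun y => φ₀ y) ξ = (𝓕 φ₀) (ξ / (2 * π)) := by
  rw [SchwartzMap.fourier_coe, fourier_real_eq_integral_exp_smul, fourierInt1]
  congr 1
  ext v
  rw [smul_eq_mul]
  congr 2
  have : -2 * π * v * (ξ / (2 * π)) = - (v * ξ) := by
    field_simp
  rw [this]
  push_cast
  ring

lemma fourierInt1_even (φ₀ : SchwartzMap ℝ ℂ) (heven : ∀ y : ℝ, φ₀ (-y) = φ₀ y) (ξ : ℝ) :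
    fourierInt1 (fun y => φ₀ y) (-ξ) = fourierInt1 (fun y => φ₀ y) ξ := by
  unfold fourierInt1
  rw [← integral_neg_eq_self]
  congr 1
  ext v
  simp [heven]

lemma fourierInt1_cont (φ₀ : SchwartzMap ℝ ℂ) : Continuous (fourierInt1 (fun y => φ₀ y)) := by
  have : fourierInt1 (fun y => φ₀ y) = fun ξ => (𝓕 φ₀) (ξ / (2 * π)) := funext (fourierInt1_eq φ₀)
  rw [this]
  exact (𝓕 φ₀).continuous.comp (by fun_prop)

lemma fourierInt1_decay (φ₀ : SchwartzMap ℝ ℂ) (k : ℕ) :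
    ∃ C, ∀ ξ, |ξ| ^ k * ‖fourierInt1 (fun y => φ₀ y) ξ‖ ≤ C := by
  obtain ⟨C, hC0, hC⟩ := (𝓕 φ₀).decay k 0
  refine ⟨(2 * π) ^ k * C, fun ξ => ?_⟩
  have := hC (ξ / (2 * π))
  rw [norm_iteratedFDeriv_zero, ← fourierInt1_eq, norm_div, Real.norm_eq_abs, Real.norm_eq_abs,
    abs_of_pos two_pi_pos, div_pow, div_mul_eq_mul_div, div_le_iff₀ (by positivity)] at this
  linarith

lemma decay_mul (F : ℝ → ℂ) (hd : ∀ k : ℕ, ∃ C, ∀ ξ, |ξ| ^ k * ‖F ξ‖ ≤ C) (E : ℝ → ℂ) (B : ℝ)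
    (hE : ∀ ξ, ‖E ξ‖ ≤ B) : ∀ k : ℕ, ∃ C, ∀ ξ, |ξ| ^ k * ‖E ξ * F ξ‖ ≤ C := by
  intro k
  obtain ⟨C, hC⟩ := hd k
  have hB : 0 ≤ B := (norm_nonneg _).trans (hE 0)
  refine ⟨B * C, fun ξ => ?_⟩
  rw [norm_mul]
  calc |ξ| ^ k * (‖E ξ‖ * ‖F ξ‖) = ‖E ξ‖ * (|ξ| ^ k * ‖F ξ‖) := by ring
    _ ≤ B * C := mul_le_mul (hE ξ) (hC ξ) (by positivity) hB

/-- abstract change of variables and Plancherel -/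
lemma core (β : ℝ) (hβ : 0 < β) (h : ℝ → ℂ) (h1 : IntegrableOn h (Set.Ioi 0))
    (h2 : IntegrableOn (fun ξ => ξ ^ (1 - β) * ‖h ξ‖ ^ 2) (Set.Ioi 0)) :
    ∫ t : ℝ, ‖∫ ξ in Set.Ioi (0:ℝ), Complex.exp (-(Complex.I * (t : ℂ) * ((ξ ^ β : ℝ) : ℂ))) * h ξ‖ ^ 2
      = 2 * π / β * ∫ ξ in Set.Ioi (0:ℝ), ξ ^ (1 - β) * ‖h ξ‖ ^ 2 := by
  set g : ℝ → ℂ := fun s => (((β * (s ^ β⁻¹) ^ (β - 1))⁻¹ : ℝ) : ℂ) * h (s ^ β⁻¹) with hg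
  have hgx : ∀ ξ ∈ Set.Ioi (0:ℝ), g (ξ ^ β) = (((β * ξ ^ (β - 1))⁻¹ : ℝ) : ℂ) * h ξ := by
    intro ξ hξ
    simp only [hg, rpow_rpow_inv (le_of_lt hξ) hβ.ne']
  have hpos : ∀ ξ ∈ Set.Ioi (0:ℝ), 0 < β * ξ ^ (β - 1) := fun ξ hξ =>
    mul_pos hβ (rpow_pos_of_pos hξ _)
  have g1 : IntegrableOn g (Set.Ioi 0) := by
    rw [← integrableOn_Ioi_comp_rpow_iff g hβ.ne']
    refine h1.congr_fun ?_ measurableSet_Ioi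
    intro ξ hξ
    have hne : ((β * ξ ^ (β - 1) : ℝ) : ℂ) ≠ 0 := Complex.ofReal_ne_zero.2 (hpos ξ hξ).ne'
    simp only [hgx ξ hξ, abs_of_pos hβ, Complex.real_smul]
    rw [Complex.ofReal_inv, mul_inv_cancel_left₀ hne]
  have sqeq : ∀ ξ ∈ Set.Ioi (0:ℝ), (β * ξ ^ (β - 1)) • ‖g (ξ ^ β)‖ ^ 2
      = β⁻¹ * (ξ ^ (1 - β) * ‖h ξ‖ ^ 2) := by
    intro ξ hξ
    have hp := hpos ξ hξ
    have hq : 0 < ξ ^ (β - 1) := rpow_pos_of_pos hξ _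
    have e : ξ ^ (1 - β) = (ξ ^ (β - 1))⁻¹ := by
      rw [← rpow_neg (le_of_lt hξ)]; congr 1; ring
    rw [hgx ξ hξ, norm_mul, Complex.norm_real, norm_of_nonneg (by positivity), e, smul_eq_mul]
    field_simp
  have g2 : IntegrableOn (fun s => ‖g s‖ ^ 2) (Set.Ioi 0) := by
    rw [← integrableOn_Ioi_comp_rpow_iff _ hβ.ne']
    refine IntegrableOn.congr_fun (h2.const_mul β⁻¹) ?_ measurableSet_Ioi
    intro ξ hξ
    simp only [abs_of_pos hβ]
    exact (sqeq ξ hξ).symm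
  set G := (Set.Ioi (0:ℝ)).indicator g with hG
  have G1 : Integrable G := g1.integrable_indicator measurableSet_Ioi
  have Gsq : (fun s => ‖G s‖ ^ 2) = (Set.Ioi (0:ℝ)).indicator (fun s => ‖g s‖ ^ 2) := by
    ext s
    by_cases hs : s ∈ Set.Ioi (0:ℝ)
    · simp only [hG, Set.indicator_of_mem hs]
    · simp [hG, Set.indicator_of_notMem hs]
  have G2 : MemLp G 2 := by
    rw [memLp_two_iff_integrable_sq_norm G1.aestronglyMeasurable, Gsq]
    exact g2.integrable_indicator measurableSet_Ioi
  have P := planch G G1 G2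
  have R : ∫ s, ‖G s‖ ^ 2 = β⁻¹ * ∫ ξ in Set.Ioi (0:ℝ), ξ ^ (1 - β) * ‖h ξ‖ ^ 2 := by
    rw [Gsq, integral_indicator measurableSet_Ioi, ← integral_comp_rpow_Ioi_of_pos hβ,
      setIntegral_congr_fun measurableSet_Ioi sqeq, integral_const_mul]
  have Q : ∀ t : ℝ, ∫ ξ in Set.Ioi (0:ℝ), Complex.exp (-(Complex.I * (t : ℂ) * ((ξ ^ β : ℝ) : ℂ))) * h ξ
      = 𝓕 G (t / (2 * π)) := by
    intro t
    rw [fourier_real_eq_integral_exp_smul]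
    have : (fun v : ℝ => Complex.exp (↑(-2 * π * v * (t / (2 * π))) * Complex.I) • G v)
        = (Set.Ioi (0:ℝ)).indicator (fun v => Complex.exp (-(Complex.I * (t : ℂ) * (v : ℂ))) * g v) := by
      ext v
      by_cases hs : v ∈ Set.Ioi (0:ℝ)
      · simp only [hG, Set.indicator_of_mem hs, smul_eq_mul]
        congr 2
        have : -2 * π * v * (t / (2 * π)) = - (v * t) := by field_simp
        rw [this]; push_cast; ring
      · simp [hG, Set.indicator_of_notMem hs]
    rw [this, integral_indicator measurableSet_Ioi, ← integral_comp_rpow_Ioi_of_pos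
      (g := fun v : ℝ => Complex.exp (-(Complex.I * (t : ℂ) * (v : ℂ))) * g v) hβ]
    refine setIntegral_congr_fun measurableSet_Ioi ?_
    intro ξ hξ
    have hne : ((β * ξ ^ (β - 1) : ℝ) : ℂ) ≠ 0 := Complex.ofReal_ne_zero.2 (hpos ξ hξ).ne'
    simp only [hgx ξ hξ, Complex.real_smul]
    rw [mul_left_comm, Complex.ofReal_inv, mul_inv_cancel_left₀ hne]
  simp_rw [Q]
  rw [Measure.integral_comp_div (fun w => ‖𝓕 G w‖ ^ 2) (2 * π), P, R, abs_of_pos two_pi_pos, smul_eq_mul]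
  ring

/-- For even data on `ℝ` and `β - 2α < 2`, `β > 0`, the time integral of
`| |∇|^α φ(x,t) |²` equals
`(2πβ)⁻¹ ∫ (1 + e^{2 i x ξ}) |ξ|^{-(β-1-2α)} |φ̂₀(ξ)|² dξ`. -/
theorem time_integral_even_data_1d (α β : ℝ) (hα : 0 ≤ α) (hβ : 0 < β)
    (h2 : β - 2 * α < 2) (φ₀ : SchwartzMap ℝ ℂ) (heven : ∀ y : ℝ, φ₀ (-y) = φ₀ y)
    (x : ℝ) :
    ((∫ t : ℝ, ‖gradProp1 α β φ₀ x t‖ ^ 2 : ℝ) : ℂ) =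
      ((2 * π * β : ℝ) : ℂ)⁻¹ *
        ∫ ξ : ℝ,
          (1 + Complex.exp (2 * Complex.I * ((x * ξ : ℝ) : ℂ))) *
            ((|ξ| ^ (-(β - 1 - 2 * α)) : ℝ) : ℂ) *
              ((‖fourierInt1 (fun y => φ₀ y) ξ‖ ^ 2 : ℝ) : ℂ) := by
  have Fe := fourierInt1_even φ₀ heven
  have Fc := fourierInt1_cont φ₀
  have Fd := fourierInt1_decay φ₀
  unfold gradProp1
  set F := fourierInt1 (fun y => φ₀ y) with hF
  have Fb : ∃ C, ∀ ξ, ‖F ξ‖ ≤ C := by simpa using Fd 0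
  obtain ⟨B, hB⟩ := Fb
  have nexp : ∀ r : ℝ, ‖Complex.exp (Complex.I * (r : ℂ))‖ = 1 := fun r => by
    rw [mul_comm, Complex.norm_exp_ofReal_mul_I]
  have nexp' : ∀ r : ℝ, ‖Complex.exp (-(Complex.I * (r : ℂ)))‖ = 1 := fun r => by
    have := nexp (-r)
    simpa using this
  set H : ℝ → ℂ := fun ξ => ((2 * Real.cos (x * ξ) : ℝ) : ℂ) with hH
  have Hc : Continuous H := by fun_prop
  have Hb : ∀ ξ, ‖H ξ‖ ≤ 2 := fun ξ => by
    simp only [hH, Complex.norm_real, Real.norm_eq_abs, abs_mul, abs_two]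
    linarith [abs_cos_le_one (x * ξ)]
  have Hexp : ∀ ξ, H ξ = Complex.exp (Complex.I * ((x * ξ : ℝ) : ℂ)) +
      Complex.exp (-(Complex.I * ((x * ξ : ℝ) : ℂ))) := by
    intro ξ
    simp only [hH, Complex.ofReal_mul, Complex.ofReal_ofNat, Complex.ofReal_cos, Complex.two_cos]
    congr 2 <;> ring
  set h : ℝ → ℂ := fun ξ => ((ξ ^ α : ℝ) : ℂ) * (H ξ * F ξ) with hh
  have hint1 : IntegrableOn h (Set.Ioi 0) :=
    intpow _ (Hc.mul Fc) (decay_mul F Fd H 2 Hb) α (by linarith)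
  set γ := -(β - 1 - 2 * α) with hγ
  have hγ1 : -1 < γ := by rw [hγ]; linarith
  have sq : ∀ ξ ∈ Set.Ioi (0:ℝ), ((ξ ^ (1 - β) * ‖h ξ‖ ^ 2 : ℝ) : ℂ)
      = ((ξ ^ γ : ℝ) : ℂ) * ((H ξ ^ 2 * starRingEnd ℂ (F ξ)) * F ξ) := by
    intro ξ hξ
    have hξ' : 0 < ξ := hξ
    have e : ξ ^ γ = ξ ^ (1 - β) * (ξ ^ α) ^ 2 := by
      rw [← rpow_natCast, ← rpow_mul hξ'.le, ← rpow_add hξ']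
      congr 1; push_cast; rw [hγ]; ring
    have e2 : starRingEnd ℂ (F ξ) * F ξ = ((‖F ξ‖ ^ 2 : ℝ) : ℂ) := by
      rw [Complex.conj_mul']; push_cast; rfl
    rw [mul_assoc (H ξ ^ 2), e2, e, hh, hH]
    simp only [norm_mul, Complex.norm_real, Real.norm_eq_abs, mul_pow, sq_abs]
    push_cast
    ring
  have hint2c : IntegrableOn (fun ξ => ((ξ ^ γ : ℝ) : ℂ) * ((H ξ ^ 2 * starRingEnd ℂ (F ξ)) * F ξ)) (Set.Ioi 0) := by
    refine intpow _ ?_ (decay_mul F Fd _ (2 ^ 2 * B) ?_) γ hγ1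
    · exact ((Hc.pow 2).mul (Complex.continuous_conj.comp Fc)).mul Fc
    · intro ξ
      rw [norm_mul, norm_pow, RCLike.norm_conj]
      gcongr
      · exact Hb ξ
      · exact hB ξ
  have hint2 : IntegrableOn (fun ξ => ξ ^ (1 - β) * ‖h ξ‖ ^ 2) (Set.Ioi 0) := by
    have := hint2c.congr_fun (fun ξ hξ => (sq ξ hξ).symm) measurableSet_Ioi
    exact this.re
  have C := core β hβ h hint1 hint2
  -- left side
  have inner : ∀ t : ℝ, ∫ ξ : ℝ,
      ((|ξ| ^ α : ℝ) : ℂ) * Complex.exp (Complex.I * ((x * ξ : ℝ) : ℂ)) *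
        Complex.exp (-(Complex.I * (t : ℂ) * ((|ξ| ^ β : ℝ) : ℂ))) * F ξ
      = ∫ ξ in Set.Ioi (0:ℝ), Complex.exp (-(Complex.I * (t : ℂ) * ((ξ ^ β : ℝ) : ℂ))) * h ξ := by
    intro t
    have cont : Continuous fun ξ : ℝ => ((|ξ| ^ β : ℝ) : ℂ) :=
      Complex.continuous_ofReal.comp (continuous_abs.rpow_const (fun _ => Or.inr hβ.le))
    have gen : ∀ y : ℝ, IntegrableOn (fun ξ : ℝ => ((ξ ^ α : ℝ) : ℂ) *
        ((Complex.exp (Complex.I * ((y * ξ : ℝ) : ℂ)) *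
        Complex.exp (-(Complex.I * (t : ℂ) * ((|ξ| ^ β : ℝ) : ℂ)))) * F ξ)) (Set.Ioi 0) := by
      intro y
      refine intpow _ ?_ (decay_mul F Fd _ 1 ?_) α (by linarith)
      · fun_prop
      · intro ξ
        have := nexp' (t * |ξ| ^ β)
        rw [Complex.ofReal_mul, ← mul_assoc] at this
        rw [norm_mul, nexp, this, one_mul]
    rw [fold]
    · refine setIntegral_congr_fun measurableSet_Ioi ?_
      intro ξ hξ
      simp only [abs_neg, Fe, abs_of_pos (Set.mem_Ioi.1 hξ), hh, Hexp, mul_neg, Complex.ofReal_neg]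
      ring
    · refine (gen x).congr_fun ?_ measurableSet_Ioi
      intro ξ hξ
      simp only [abs_of_pos (Set.mem_Ioi.1 hξ)]
      ring
    · refine (gen (-x)).congr_fun ?_ measurableSet_Ioi
      intro ξ hξ
      simp only [abs_neg, Fe, abs_of_pos (Set.mem_Ioi.1 hξ), neg_mul, mul_neg]
      ring
  have rhs : ∫ ξ : ℝ,
          (1 + Complex.exp (2 * Complex.I * ((x * ξ : ℝ) : ℂ))) *
            ((|ξ| ^ γ : ℝ) : ℂ) * ((‖F ξ‖ ^ 2 : ℝ) : ℂ)
      = ((∫ ξ in Set.Ioi (0:ℝ), ξ ^ (1 - β) * ‖h ξ‖ ^ 2 : ℝ) : ℂ) := by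
    have e2 : ∀ ξ, ((‖F ξ‖ ^ 2 : ℝ) : ℂ) = starRingEnd ℂ (F ξ) * F ξ := fun ξ => by
      rw [Complex.conj_mul']; push_cast; rfl
    have gen : ∀ y : ℝ, IntegrableOn (fun ξ : ℝ => ((ξ ^ γ : ℝ) : ℂ) *
        (((1 + Complex.exp (Complex.I * ((2 * y * ξ : ℝ) : ℂ))) * starRingEnd ℂ (F ξ)) * F ξ)) (Set.Ioi 0) := by
      intro y
      refine intpow _ ?_ (decay_mul F Fd _ (2 * B) ?_) γ hγ1
      · exact (Continuous.mul (by fun_prop) (Complex.continuous_conj.comp Fc)).mul Fc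
      · intro ξ
        rw [norm_mul, RCLike.norm_conj]
        gcongr
        · refine (norm_add_le _ _).trans ?_
          rw [nexp, norm_one]; norm_num
        · exact hB ξ
    rw [fold, ← integral_complex_ofReal]
    · refine setIntegral_congr_fun measurableSet_Ioi ?_
      intro ξ hξ
      simp only [sq ξ hξ, abs_neg, Fe, abs_of_pos (Set.mem_Ioi.1 hξ), e2, Hexp]
      have a1 : Complex.exp (2 * Complex.I * ((x * ξ : ℝ) : ℂ)) = Complex.exp (Complex.I * ((x * ξ : ℝ) : ℂ)) ^ 2 := by
        rw [← Complex.exp_nat_mul]; congr 1; push_cast; ring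
      have a2 : Complex.exp (2 * Complex.I * ((x * -ξ : ℝ) : ℂ)) = Complex.exp (-(Complex.I * ((x * ξ : ℝ) : ℂ))) ^ 2 := by
        rw [← Complex.exp_nat_mul]; congr 1; push_cast; ring
      have a3 : Complex.exp (Complex.I * ((x * ξ : ℝ) : ℂ)) * Complex.exp (-(Complex.I * ((x * ξ : ℝ) : ℂ))) = 1 := by
        rw [← Complex.exp_add, add_neg_cancel, Complex.exp_zero]
      rw [a1, a2]
      linear_combination (-2 * ((ξ ^ γ : ℝ) : ℂ) * (starRingEnd ℂ (F ξ) * F ξ)) * a3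
    · refine (gen x).congr_fun ?_ measurableSet_Ioi
      intro ξ hξ
      simp only [abs_of_pos (Set.mem_Ioi.1 hξ), e2]
      push_cast
      ring_nf
    · refine (gen (-x)).congr_fun ?_ measurableSet_Ioi
      intro ξ hξ
      simp only [abs_neg, Fe, abs_of_pos (Set.mem_Ioi.1 hξ), e2]
      push_cast
      ring_nf
  rw [rhs]
  simp_rw [inner, norm_mul, mul_pow]
  rw [integral_const_mul, C]
  have : ‖((((2 * π : ℝ))⁻¹ : ℝ) : ℂ)‖ = (2 * π)⁻¹ := by
    rw [Complex.norm_real, norm_of_nonneg (by positivity)]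
  have hpi : (π : ℂ) ≠ 0 := Complex.ofReal_ne_zero.2 pi_ne_zero
  have hb : (β : ℂ) ≠ 0 := Complex.ofReal_ne_zero.2 hβ.ne'
  rw [this]
  push_cast
  field_simp
end
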